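/- arXiv:0906.3259 — 2 statements merged into one kernel-verified Lean document; each statement's English description precedes it below -/
import Mathlib

section
/- Let y : D → ℕ be a counting function with #F = Σ_{ζ∈D} y(ζ) > 0 and coefficients c_α. For α, β ∈ L, the terms X^α and X^β are orthogonal on the fraction F, i.e. (1/#F) Σ_{ζ∈D} y(ζ)·X^α(ζ)·conj(X^β(ζ)) = 0, if and only if c_{[α−β]} = 0. -/
open scoped BigOperators Classical

/-- The interaction term `X^α` on the full factorial design, where a design
point `ζ` is coded by its exponents: the `j`-th coordinate of the point is
`exp(2πi ζ_j / n_j)`, and `X^α(ζ) = ∏_j exp(2πi α_j ζ_j / n_j)`. -/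
noncomputable def Xterm (m : ℕ) (n : Fin m → ℕ) (α ζ : ∀ j, ZMod (n j)) : ℂ :=
  ∏ j, Complex.exp (2 * (Real.pi : ℂ) * Complex.I * ((α j).val : ℂ) * ((ζ j).val : ℂ) / (n j : ℂ))

/-- The coefficient `c_α = (1/#D) Σ_{ζ∈D} y(ζ)·conj(X^α(ζ))` of the counting
function `y` of a fraction. -/
noncomputable def coeff (m : ℕ) (n : Fin m → ℕ) [∀ j, NeZero (n j)]
    (y : (∀ j, ZMod (n j)) → ℕ) (α : ∀ j, ZMod (n j)) : ℂ :=
  (∏ j, (n j : ℂ))⁻¹ * ∑ ζ : ∀ j, ZMod (n j), (y ζ : ℂ) * (starRingEnd ℂ) (Xterm m n α ζ)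

lemma exp_val_mul_val_eq_stdAddChar {N : ℕ} [NeZero N] (a z : ZMod N) :
    Complex.exp (2 * (Real.pi : ℂ) * Complex.I * (a.val : ℂ) * (z.val : ℂ) / (N : ℂ)) =
      ZMod.stdAddChar (a * z) := by
  have h : a * z = (((a.val * z.val : ℕ) : ℤ) : ZMod N) := by
    push_cast
    simp only [ZMod.natCast_val, ZMod.cast_id', id]
  rw [h, ZMod.stdAddChar_coe]
  push_cast
  congr 1
  ring

lemma Xterm_eq_prod_stdAddChar (m : ℕ) (n : Fin m → ℕ) [∀ j, NeZero (n j)]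
    (α ζ : ∀ j, ZMod (n j)) :
    Xterm m n α ζ = ∏ j, ZMod.stdAddChar (α j * ζ j) :=
  Finset.prod_congr rfl fun _ _ => exp_val_mul_val_eq_stdAddChar _ _

lemma Xterm_mul_conj_Xterm (m : ℕ) (n : Fin m → ℕ) [∀ j, NeZero (n j)]
    (α β ζ : ∀ j, ZMod (n j)) :
    Xterm m n α ζ * (starRingEnd ℂ) (Xterm m n β ζ) = Xterm m n (α - β) ζ := by
  simp only [Xterm_eq_prod_stdAddChar, map_prod, ← Finset.prod_mul_distrib,
    ← AddChar.map_neg_eq_conj, ← AddChar.map_add_eq_mul]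
  simp only [Pi.sub_apply, sub_mul, ← sub_eq_add_neg]

/-- For a fraction of positive size, the terms `X^α` and `X^β` are orthogonal
on the fraction iff `c_{[α−β]} = 0`. -/
theorem orthogonal_iff_coeff_zero (m : ℕ) (hm : 1 ≤ m) (n : Fin m → ℕ) [∀ j, NeZero (n j)]
    (y : (∀ j, ZMod (n j)) → ℕ) (hF : 0 < ∑ ζ, y ζ) (α β : ∀ j, ZMod (n j)) :
    ((∑ ζ, y ζ : ℕ) : ℂ)⁻¹ *
        (∑ ζ, (y ζ : ℂ) * (Xterm m n α ζ * (starRingEnd ℂ) (Xterm m n β ζ))) = 0 ↔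
      coeff m n y (α - β) = 0 := by
  have hsize : ((∑ ζ, y ζ : ℕ) : ℂ) ≠ 0 := Nat.cast_ne_zero.mpr hF.ne'
  have hprod : (∏ j, (n j : ℂ)) ≠ 0 :=
    Finset.prod_ne_zero_iff.mpr fun j _ => Nat.cast_ne_zero.mpr (NeZero.ne (n j))
  have hconj : (starRingEnd ℂ) (∑ ζ, (y ζ : ℂ) * Xterm m n (α - β) ζ) =
      ∑ ζ, (y ζ : ℂ) * (starRingEnd ℂ) (Xterm m n (α - β) ζ) := by
    simp only [map_sum, map_mul, map_natCast]
  rw [coeff, mul_eq_zero_iff_left (inv_ne_zero hsize),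
    mul_eq_zero_iff_left (inv_ne_zero hprod), ← hconj, map_eq_zero]
  simp only [Xterm_mul_conj_Xterm]
end

section
/- Let y : D → ℕ be a counting function with coefficients c_α and let α ∈ L with associated level number s ≥ 1. Let P(X) = Σ_{h=0}^{s−1} n_{α,h} X^h ∈ ℤ[X] and let Φ_s be the s-th cyclotomic polynomial. Then c_α = 0 if and only if the remainder of P upon division by Φ_s is identically zero, i.e. Φ_s divides P. -/
open scoped BigOperators Classical

/-- The level number `s` associated to the term `X^α`:
`s = lcm(s_1,…,s_m)` with `s_j = 1` if `α_j = 0` and `s_j = n_j / gcd(α_j, n_j)`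
otherwise, so that `X^α` takes values in the `s`-th roots of unity `Ω_s`. -/
noncomputable def levelS (m : ℕ) (n : Fin m → ℕ) (α : ∀ j, ZMod (n j)) : ℕ :=
  Finset.univ.lcm (fun j => if α j = 0 then 1 else n j / Nat.gcd (α j).val (n j))

/-- The strata count `n_{α,h} = Σ_{ζ ∈ D_h^α} y(ζ)`, where
`D_h^α = {ζ ∈ D : conj(X^α(ζ)) = exp(2πi h/s)}` and `s = levelS m n α`. -/
noncomputable def strataCount (m : ℕ) (n : Fin m → ℕ) [∀ j, NeZero (n j)]
    (y : (∀ j, ZMod (n j)) → ℕ) (α : ∀ j, ZMod (n j)) (h : ℕ) : ℕ :=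
  ∑ ζ ∈ Finset.univ.filter (fun ζ => (starRingEnd ℂ) (Xterm m n α ζ) =
      Complex.exp (2 * (Real.pi : ℂ) * Complex.I * (h : ℂ) / (levelS m n α : ℂ))), y ζ

theorem Xterm_pow_levelS (m : ℕ) (n : Fin m → ℕ) [∀ j, NeZero (n j)]
    (α ζ : ∀ j, ZMod (n j)) : Xterm m n α ζ ^ levelS m n α = 1 := by
  rw [Xterm, ← Finset.prod_pow]
  refine Finset.prod_eq_one fun j _ => ?_
  have hlevel : n j ∣ (α j).val * levelS m n α := by
    have hj : (if α j = 0 then 1 else n j / Nat.gcd (α j).val (n j)) ∣ levelS m n α :=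
      Finset.dvd_lcm (f := fun j => if α j = 0 then 1 else n j / Nat.gcd (α j).val (n j))
        (Finset.mem_univ j)
    by_cases h0 : α j = 0
    · simp [h0]
    · rw [if_neg h0] at hj
      refine dvd_trans ?_ (mul_dvd_mul_left _ hj)
      rw [← Nat.mul_div_assoc _ (Nat.gcd_dvd_right _ _), mul_comm,
        Nat.mul_div_assoc _ (Nat.gcd_dvd_left _ _)]
      exact dvd_mul_right _ _
  obtain ⟨k, hk⟩ := hlevel
  have hn : (n j : ℂ) ≠ 0 := Nat.cast_ne_zero.2 (NeZero.ne _)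
  have hk' : ((α j).val : ℂ) * (levelS m n α : ℂ) = n j * k := by exact_mod_cast hk
  rw [← Complex.exp_nat_mul, Complex.exp_eq_one_iff]
  refine ⟨(k * (ζ j).val : ℕ), ?_⟩
  push_cast
  field_simp
  linear_combination ((ζ j).val : ℂ) * hk'

theorem exp_mul_div_eq_pow (s h : ℕ) :
    Complex.exp (2 * (Real.pi : ℂ) * Complex.I * (h : ℂ) / (s : ℂ)) =
      Complex.exp (2 * (Real.pi : ℂ) * Complex.I / (s : ℂ)) ^ h := by
  rw [← Complex.exp_nat_mul]
  congr 1
  ring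

theorem sum_strataCount_mul_pow (m : ℕ) (n : Fin m → ℕ) [∀ j, NeZero (n j)]
    (y : (∀ j, ZMod (n j)) → ℕ) (α : ∀ j, ZMod (n j)) (hs : levelS m n α ≠ 0) :
    ∑ h ∈ Finset.range (levelS m n α), (strataCount m n y α h : ℂ) *
        Complex.exp (2 * (Real.pi : ℂ) * Complex.I / (levelS m n α : ℂ)) ^ h =
      ∑ ζ : ∀ j, ZMod (n j), (y ζ : ℂ) * (starRingEnd ℂ) (Xterm m n α ζ) := by
  have hprim := Complex.isPrimitiveRoot_exp _ hs
  have : NeZero (levelS m n α) := ⟨hs⟩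
  simp only [strataCount, exp_mul_div_eq_pow, Nat.cast_sum, Finset.sum_mul, Finset.sum_filter]
  rw [Finset.sum_comm]
  refine Finset.sum_congr rfl fun ζ _ => ?_
  obtain ⟨h, hlt, hpow⟩ := hprim.eq_pow_of_pow_eq_one
    (show (starRingEnd ℂ) (Xterm m n α ζ) ^ levelS m n α = 1 by
      rw [← map_pow, Xterm_pow_levelS, map_one])
  rw [Finset.sum_eq_single_of_mem h (Finset.mem_range.2 hlt), if_pos hpow.symm, hpow]
  intro b hb hbh
  rw [if_neg fun hb' => hbh (hprim.pow_inj (Finset.mem_range.1 hb) hlt (hb'.symm.trans hpow.symm)),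
    Nat.cast_zero, zero_mul]

/-- For a term `X^α` with level number `s ≥ 1`, letting
`P(X) = Σ_{h=0}^{s−1} n_{α,h} X^h ∈ ℤ[X]` and `Φ_s` be the `s`-th cyclotomic
polynomial, `c_α = 0` iff the remainder of `P` upon division by `Φ_s` is
identically zero, i.e. `Φ_s ∣ P`. -/
theorem coeff_zero_iff_cyclotomic_dvd (m : ℕ) (hm : 1 ≤ m) (n : Fin m → ℕ) [∀ j, NeZero (n j)]
    (y : (∀ j, ZMod (n j)) → ℕ) (α : ∀ j, ZMod (n j)) (hs : 1 ≤ levelS m n α) :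
    coeff m n y α = 0 ↔
      Polynomial.cyclotomic (levelS m n α) ℤ ∣
        ∑ h ∈ Finset.range (levelS m n α),
          Polynomial.C ((strataCount m n y α h : ℤ)) * Polynomial.X ^ h := by
  have hs0 : levelS m n α ≠ 0 := Nat.one_le_iff_ne_zero.1 hs
  have hprim := Complex.isPrimitiveRoot_exp _ hs0
  have hprod : (∏ j, (n j : ℂ))⁻¹ ≠ 0 :=
    inv_ne_zero (Finset.prod_ne_zero_iff.2 fun j _ => Nat.cast_ne_zero.2 (NeZero.ne _))
  rw [Polynomial.cyclotomic_eq_minpoly hprim hs,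
    ← minpoly.isIntegrallyClosed_dvd_iff (hprim.isIntegral hs), coeff, mul_eq_zero,
    or_iff_right hprod, ← sum_strataCount_mul_pow m n y α hs0]
  simp
end
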